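/- For every natural number n ≥ 0, Ewell's recurrence relating distinct partitions to unrestricted partitions holds: Q(n) = P(n) + ∑_{k=1}^{∞} (−1)^k ( P(n − k(3k−1)) + P(n − k(3k+1)) ), where the sum is over all positive integers k for which the argument of P is nonnegative, and P of a negative argument is 0. -/

import Mathlib

/-- `P n`, the number of integer partitions of `n`. -/
def partitionCount (n : ℕ) : ℕ := Fintype.card (Nat.Partition n)

/-- `Q n`, the number of integer partitions of `n` into pairwise distinct parts. -/
def distinctPartitionCount (n : ℕ) : ℕ :=
  Fintype.card {p : n.Partition // p.parts.Nodup}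

open PowerSeries PowerSeries.WithPiTopology

/-- Substituting `X ^ p` for `X` is continuous in the product topology on power series. -/
theorem PowerSeries.WithPiTopology.continuous_expand {R : Type*} [CommRing R]
    [TopologicalSpace R] {p : ℕ} (hp : p ≠ 0) :
    Continuous (expand p hp : R⟦X⟧ → R⟦X⟧) := by
  refine continuous_iff_continuousAt.mpr fun g ↦ (tendsto_iff_coeff_tendsto ..).mpr fun d ↦ ?_
  simp only [coeff_expand]
  split_ifs
  · exact (continuous_coeff R _).continuousAt
  · exact tendsto_const_nhds

/-- The generating function of `partitionCount` is the inverse of the pentagonal series. -/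
theorem mk_partitionCount_mul_pentagonalSeries :
    (PowerSeries.mk fun n ↦ (partitionCount n : ℤ)) * pentagonalSeries ℤ = 1 := by
  have hP := Nat.Partition.hasProd_powerSeriesMk_card_restricted ℤ (fun _ ↦ True)
  have h := hP.mul (hasProd_one_sub_X_pow ℤ)
  have hcount (n : ℕ) : (Nat.Partition.restricted n fun _ ↦ True).card = partitionCount n := by
    simp [Nat.Partition.restricted, partitionCount, Finset.card_univ]
  simp only [if_true, hcount, pow_mul] at h
  refine h.unique ?_
  convert! hasProd_one using 2 with i
  exact tsum_pow_mul_one_sub_of_constantCoeff_eq_zero (by simp)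

/-- The generating function of `distinctPartitionCount` times the pentagonal series is the
pentagonal series in `X ^ 2`, since `(1 + X ^ i) * (1 - X ^ i) = 1 - X ^ (2 * i)`. -/
theorem mk_distinctPartitionCount_mul_pentagonalSeries :
    (PowerSeries.mk fun n ↦ (distinctPartitionCount n : ℤ)) * pentagonalSeries ℤ =
      expand 2 two_ne_zero (pentagonalSeries ℤ) := by
  have hQ := Nat.Partition.hasProd_powerSeriesMk_card_countRestricted ℤ (m := 2) two_pos
  have h := hQ.mul (hasProd_one_sub_X_pow ℤ)
  have hcount (n : ℕ) :
      (Nat.Partition.countRestricted n 2).card = distinctPartitionCount n := by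
    rw [Nat.Partition.countRestricted_two, distinctPartitionCount, Fintype.card_subtype,
      Nat.Partition.distincts]
  simp only [hcount] at h
  refine h.unique ?_
  convert! (hasProd_one_sub_X_pow ℤ).map (expand 2 two_ne_zero) (continuous_expand _) using 2 with i
  simp [Finset.sum_range_succ]
  ring

theorem mk_distinctPartitionCount_eq_expand_mul :
    (PowerSeries.mk fun n ↦ (distinctPartitionCount n : ℤ)) =
      expand 2 two_ne_zero (pentagonalSeries ℤ) *
        PowerSeries.mk fun n ↦ (partitionCount n : ℤ) := by
  rw [← mk_distinctPartitionCount_mul_pentagonalSeries, mul_assoc,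
    mul_comm (pentagonalSeries ℤ), mk_partitionCount_mul_pentagonalSeries, mul_one]

/-- The recurrence for `distinctPartitionCount` as a sum over all integers. -/
theorem hasSum_negOnePow_mul_partitionCount (n : ℕ) :
    HasSum (fun k : ℤ ↦ (Int.negOnePow k : ℤ) *
        if 2 * pentagonal k ≤ n then (partitionCount (n - 2 * pentagonal k) : ℤ) else 0)
      (distinctPartitionCount n : ℤ) := by
  have hE := (hasSum_pentagonalSeries ℤ).map (expand 2 two_ne_zero) (continuous_expand _)
  have h := (hE.mul_right (PowerSeries.mk fun n ↦ (partitionCount n : ℤ))).map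
    (coeff n) (continuous_coeff ℤ n)
  rw [← mk_distinctPartitionCount_eq_expand_mul, coeff_mk] at h
  convert! h using 2 with k
  rw [Function.comp_apply, Function.comp_apply, map_mul (expand 2 _), map_intCast, map_pow,
    expand_X, ← pow_mul, mul_assoc, ← map_intCast (C (R := ℤ)), coeff_C_mul, coeff_X_pow_mul',
    coeff_mk, Int.cast_id]

/-- Ewell's recurrence relating distinct partitions to unrestricted partitions:
`Q(n) = P(n) + ∑_{k=1}^{∞} (−1)^k (P(n − k(3k−1)) + P(n − k(3k+1)))`,
where terms with negative argument of `P` are zero.  All nonzero terms have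
`k ≤ n`, so the sum is taken over `1 ≤ k ≤ n`. -/
theorem ewell_distinct_recurrence (n : ℕ) :
    (distinctPartitionCount n : ℤ) =
      (partitionCount n : ℤ) +
        ∑ k ∈ Finset.Icc 1 n,
          (-1 : ℤ) ^ k *
            ((if k * (3 * k - 1) ≤ n then
                (partitionCount (n - k * (3 * k - 1)) : ℤ) else 0) +
              (if k * (3 * k + 1) ≤ n then
                (partitionCount (n - k * (3 * k + 1)) : ℤ) else 0)) := by
  have h := (hasSum_negOnePow_mul_partitionCount n).nat_add_neg
  have hpos (k : ℕ) : 2 * pentagonal k = k * (3 * k - 1) := by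
    rcases k with _ | k
    · simp [pentagonal_def]
    · zify [show 1 ≤ 3 * (k + 1) by lia]
      exact_mod_cast two_mul_natCast_pentagonal (k + 1)
  have hneg (k : ℕ) : 2 * pentagonal (-k) = k * (3 * k + 1) := by
    exact_mod_cast two_mul_natCast_pentagonal_neg k
  simp only [hpos, hneg, Int.negOnePow_neg, ← mul_add] at h
  have hfin := h.unique (hasSum_sum_of_ne_finset_zero (s := Finset.range (n + 1)) ?_)
  · rw [Finset.range_eq_Ico, Finset.sum_eq_sum_Ico_succ_bot (by simp)] at hfin
    simp [pentagonal_def, Int.negOnePow_def, Finset.Ico_add_one_right_eq_Icc] at hfin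
    linarith
  · intro k hk
    have hk : n < k := by simpa using hk
    have h1 : n < k * (3 * k - 1) := by nlinarith [show 2 ≤ 3 * k - 1 by lia]
    have h2 : n < k * (3 * k + 1) := by nlinarith
    simp [h1.not_ge, h2.not_ge]
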